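/- There exists N such that for all n ≥ N the following holds. Let 𝕊 be a finite set and μ a distribution on {0,1}^n × 𝕊 of pairs (k, s); for each s in the support of the 𝕊-marginal, let K_s denote the conditional distribution of k given s. Let {h_σ : {0,1}^n → {0,1}^{3n}}_{σ∈Σ} be a pairwise independent family with finite seed set Σ. Suppose that for each s in the support there are: an integer j_s with 0 ≤ j_s ≤ 2n−1 such that G_s := {k : 2^{−(j_s+1)} ≤ K_s(k) ≤ 2^{−j_s}} satisfies K_s(G_s) ≥ 1/(3n); the index i_s := j_s + ⌈600·log₂ n⌉ satisfying i_s ≤ 3n; and a set F_s ⊆ Σ × {0,1}^{i_s} such that (a) Pr_{σ←Σ, k←K_s}[ (σ, h_σ(k)_{i_s}) ∈ F_s ] ≥ 1/(6n) − 1/n^100, and (b) for every (σ, y) ∈ F_s, Pr_{k←K_s}[ k ∈ G_s | h_σ(k)_{i_s} = y ] ≥ 1/(6n) and at most one k with K_s(k) ≥ 2^{−j_s}·n^{−500} satisfies h_σ(k)_{i_s} = y. Define G₀ as the distribution of the tuple (s, σ, i, r, (i, h_σ(k)_i), ⟨k,r⟩) and G₁ as the distribution of (s, σ, i, r, (i,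 h_σ(k)_i), b), where (k,s) ← μ, σ ← Σ uniform, i uniform in {1,…,3n}, r ← U_n, all independent; in G₁ the bit b is uniform and independent of everything else if i = i_s, k ∈ G_s, and (σ, h_σ(k)_{i_s}) ∈ F_s, and b = ⟨k,r⟩ otherwise (prefixes h_σ(k)_i of different lengths are encoded together with the index i in a common finite set, e.g., by padding to 3n bits). Then H(G₁) − H(G₀) ≥ 1/n⁵. -/

import Mathlib

/-- The base-2 Shannon entropy of a distribution `P` on a finite set,
with the convention `0 * log₂ 0 = 0` (note `Real.logb 2 0 = 0`). -/
noncomputable def shannonH {S : Type*} [Fintype S] (P : S → ℝ) : ℝ :=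
  ∑ x, -(P x * Real.logb 2 (P x))

/-- `P` is a probability distribution on the finite set `S`. -/
def IsDist {S : Type*} [Fintype S] (P : S → ℝ) : Prop :=
  (∀ x, 0 ≤ P x) ∧ (∑ x, P x) = 1

/-- Boolean inner product of two length-`n` bit strings. -/
def ip {n : ℕ} (x r : Fin n → ZMod 2) : ZMod 2 := ∑ i, x i * r i

/-- The length-`i` prefix of `w : {0,1}^{3n}`, encoded by padding with zeroes to `3n` bits. -/
def padPrefix (n i : ℕ) (w : Fin (3 * n) → ZMod 2) : Fin (3 * n) → ZMod 2 :=
  fun t => if (t : ℕ) < i then w t else 0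

/-- The conditional distribution `K_s` of `k` given `s` (for `μ` a joint distribution). -/
noncomputable def condKs {n : ℕ} {𝕊 : Type*} (μ : (Fin n → ZMod 2) × 𝕊 → ℝ) (s : 𝕊)
    (k : Fin n → ZMod 2) : ℝ :=
  μ (k, s) / (∑ k', μ (k', s))

/-- `i_s := j_s + ⌈600·log₂ n⌉`. -/
noncomputable def iIdx (n j : ℕ) : ℕ := j + ⌈(600 : ℝ) * Real.logb 2 (n : ℝ)⌉₊

/-- Membership in `G_s = {k : 2^{-(j+1)} ≤ K_s k ≤ 2^{-j}}`. -/
def inG {n : ℕ} (Kd : (Fin n → ZMod 2) → ℝ) (j : ℕ) (k : Fin n → ZMod 2) : Prop :=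
  1 / 2 ^ (j + 1) ≤ Kd k ∧ Kd k ≤ 1 / 2 ^ j

noncomputable instance {n : ℕ} (Kd : (Fin n → ZMod 2) → ℝ) (j : ℕ) (k : Fin n → ZMod 2) :
    Decidable (inG Kd j k) := by
  unfold inG; infer_instance

/-- The distribution `G₀` of `(s, σ, i, r, (i, h_σ(k)_i), ⟨k,r⟩)` where `(k,s) ← μ`,
`σ ← Σ` uniform, `i` uniform in `{1,…,3n}` (encoded as `iv : Fin (3n)` with `i = iv + 1`),
`r ← U_n`, all independent; the prefix `h_σ(k)_i` is encoded (together with `i`, which is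
already a component of the tuple) by zero-padding to `3n` bits. -/
noncomputable def G0dist (n : ℕ) {𝕊 Sg : Type*} [Fintype Sg]
    (μ : (Fin n → ZMod 2) × 𝕊 → ℝ) (h : Sg → (Fin n → ZMod 2) → (Fin (3 * n) → ZMod 2)) :
    𝕊 × Sg × Fin (3 * n) × (Fin n → ZMod 2) × (Fin (3 * n) → ZMod 2) × ZMod 2 → ℝ :=
  fun t =>
    (1 / ((Fintype.card Sg : ℝ) * (3 * n) * 2 ^ n)) *
      ∑ k, if padPrefix n ((t.2.2.1 : ℕ) + 1) (h t.2.1 k) = t.2.2.2.2.1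
              ∧ ip k t.2.2.2.1 = t.2.2.2.2.2
           then μ (k, t.1) else 0

/-- The distribution `G₁`: identical to `G₀` except that the final bit is uniform and
independent when `i = i_s`, `k ∈ G_s` and `(σ, h_σ(k)_{i_s}) ∈ F_s`. -/
noncomputable def G1dist (n : ℕ) {𝕊 Sg : Type*} [Fintype Sg] [DecidableEq Sg]
    (μ : (Fin n → ZMod 2) × 𝕊 → ℝ) (h : Sg → (Fin n → ZMod 2) → (Fin (3 * n) → ZMod 2))
    (j : 𝕊 → ℕ) (F : 𝕊 → Finset (Sg × (Fin (3 * n) → ZMod 2))) :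
    𝕊 × Sg × Fin (3 * n) × (Fin n → ZMod 2) × (Fin (3 * n) → ZMod 2) × ZMod 2 → ℝ :=
  fun t =>
    (1 / ((Fintype.card Sg : ℝ) * (3 * n) * 2 ^ n)) *
      ∑ k,
        if (t.2.2.1 : ℕ) + 1 = iIdx n (j t.1)
            ∧ inG (condKs μ t.1) (j t.1) k
            ∧ (t.2.1, padPrefix n (iIdx n (j t.1)) (h t.2.1 k)) ∈ F t.1
        then (if padPrefix n ((t.2.2.1 : ℕ) + 1) (h t.2.1 k) = t.2.2.2.2.1
              then μ (k, t.1) / 2 else 0)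
        else (if padPrefix n ((t.2.2.1 : ℕ) + 1) (h t.2.1 k) = t.2.2.2.2.1
                  ∧ ip k t.2.2.2.1 = t.2.2.2.2.2
              then μ (k, t.1) else 0)

lemma negMulLog_le_of_le_two {t : ℝ} (h0 : 0 ≤ t) (h2 : t ≤ 2) :
    Real.negMulLog t ≤ 1 - t - (t - 1) ^ 2 / 6 := by
  rcases h0.eq_or_lt with rfl | ht
  · norm_num
  have hs : 0 < √t := Real.sqrt_pos.2 ht
  have hsq : √t * √t = t := Real.mul_self_sqrt h0
  have hlog : 2 * (1 - (√t)⁻¹) ≤ Real.log t := by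
    have h1 := Real.one_sub_inv_le_log_of_pos hs
    have h3 : Real.log t = 2 * Real.log √t := by
      rw [Real.log_sqrt h0]; ring
    linarith
  have h4 : t * (√t)⁻¹ = √t := by
    rw [← div_eq_mul_inv, Real.div_sqrt]
  have h5 : 2 * t - 2 * √t ≤ t * Real.log t := by
    have := mul_le_mul_of_nonneg_left hlog h0
    nlinarith
  have h6 : √t ≤ 1.42 := by
    rw [Real.sqrt_le_iff]; norm_num; linarith
  have h7 : (t - 1) ^ 2 / 6 ≤ (√t - 1) ^ 2 := by
    have h8 : (t - 1) ^ 2 = (√t - 1) ^ 2 * (√t + 1) ^ 2 := by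
      rw [← mul_pow]; congr 1; nlinarith
    have h9 : (√t + 1) ^ 2 ≤ 6 := by nlinarith
    have := mul_le_mul_of_nonneg_left h9 (sq_nonneg (√t - 1))
    linarith
  rw [Real.negMulLog]
  nlinarith

lemma mul_one_sub_le_negMulLog {t : ℝ} (h0 : 0 ≤ t) : t * (1 - t) ≤ Real.negMulLog t := by
  rcases h0.eq_or_lt with rfl | ht
  · norm_num
  have h1 := Real.log_le_sub_one_of_pos ht
  rw [Real.negMulLog]
  nlinarith

/-- Two-point entropy comparison in terms of the biases `a - b` and `c - d`. -/
lemma negMulLog_pair_gain {a b c d m : ℝ} (ha : 0 ≤ a) (hb : 0 ≤ b) (hc : 0 ≤ c) (hd : 0 ≤ d)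
    (hm : 0 < m) (hab : a + b = m) (hcd : c + d = m) :
    (a - b) ^ 2 / (6 * m) - (c - d) ^ 2 / m ≤
      (Real.negMulLog c + Real.negMulLog d) - (Real.negMulLog a + Real.negMulLog b) := by
  have key : ∀ x : ℝ, Real.negMulLog x =
      (2 * x / m) * Real.negMulLog (m / 2) + m / 2 * Real.negMulLog (2 * x / m) := by
    intro x
    rw [← Real.negMulLog_mul]
    congr 1
    field_simp
  have hup : ∀ x : ℝ, 0 ≤ x → x ≤ m → m / 2 * Real.negMulLog (2 * x / m) ≤
      m / 2 * (1 - 2 * x / m - (2 * x / m - 1) ^ 2 / 6) := fun x h0 h1 =>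
    mul_le_mul_of_nonneg_left
      (negMulLog_le_of_le_two (by positivity) (by rw [div_le_iff₀ hm]; linarith)) (by positivity)
  have hlo : ∀ x : ℝ, 0 ≤ x →
      m / 2 * (2 * x / m * (1 - 2 * x / m)) ≤ m / 2 * Real.negMulLog (2 * x / m) := fun x h0 =>
    mul_le_mul_of_nonneg_left (mul_one_sub_le_negMulLog (by positivity)) (by positivity)
  have ha' := hup a ha (by linarith)
  have hb' := hup b hb (by linarith)
  have hc' := hlo c hc
  have hd' := hlo d hd
  rw [key a, key b, key c, key d]
  have e1 : 2 * a / m + 2 * b / m = 2 := by field_simp; linarith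
  have e2 : 2 * c / m + 2 * d / m = 2 := by field_simp; linarith
  have e3 : (a - b) ^ 2 / (6 * m) = -(m / 2 * (1 - 2 * a / m - (2 * a / m - 1) ^ 2 / 6)
      + m / 2 * (1 - 2 * b / m - (2 * b / m - 1) ^ 2 / 6)) := by
    obtain rfl : b = m - a := by linarith
    field_simp; ring
  have e4 : (c - d) ^ 2 / m = -(m / 2 * (2 * c / m * (1 - 2 * c / m))
      + m / 2 * (2 * d / m * (1 - 2 * d / m))) := by
    obtain rfl : d = m - c := by linarith
    field_simp; ring
  have e5 : 2 * a / m * Real.negMulLog (m / 2) + 2 * b / m * Real.negMulLog (m / 2) =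
    2 * c / m * Real.negMulLog (m / 2) + 2 * d / m * Real.negMulLog (m / 2) := by
    rw [← add_mul, ← add_mul, e1, e2]
  linarith

/-- The character `r ↦ (-1)^⟨k,r⟩`. -/
noncomputable def chi {n : ℕ} (k r : Fin n → ZMod 2) : ℝ := if ip k r = 0 then 1 else -1

lemma ip_add_left {n : ℕ} (k l r : Fin n → ZMod 2) : ip (k + l) r = ip k r + ip l r := by
  simp [ip, add_mul, Finset.sum_add_distrib]

lemma ip_add_right {n : ℕ} (k r t : Fin n → ZMod 2) : ip k (r + t) = ip k r + ip k t := by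
  simp [ip, mul_add, Finset.sum_add_distrib]

lemma sign_add (a b : ZMod 2) :
    (if a + b = 0 then (1 : ℝ) else -1) =
      (if a = 0 then (1 : ℝ) else -1) * (if b = 0 then (1 : ℝ) else -1) := by
  have h2 : ∀ a b : ZMod 2, a + b = 0 ↔ a = b := by decide
  have h3 : ∀ a : ZMod 2, a = 0 ∨ a = 1 := by decide
  simp only [h2]
  rcases h3 a with rfl | rfl <;> rcases h3 b with rfl | rfl <;> simp

lemma chi_add_left {n : ℕ} (k l r : Fin n → ZMod 2) : chi (k + l) r = chi k r * chi l r := by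
  simp only [chi, ip_add_left, sign_add]

lemma chi_add_right {n : ℕ} (k r t : Fin n → ZMod 2) : chi k (r + t) = chi k r * chi k t := by
  simp only [chi, ip_add_right, sign_add]

lemma sum_chi_eq_zero {n : ℕ} {k : Fin n → ZMod 2} (hk : k ≠ 0) : ∑ r, chi k r = 0 := by
  obtain ⟨i, hi⟩ := Function.ne_iff.1 hk
  have hchi : chi k (Pi.single i 1) = -1 := by
    have : ip k (Pi.single i 1) = k i := by simp [ip, Pi.single_apply]
    rw [chi, this, if_neg (by simpa using hi)]
  have h := Equiv.sum_comp (Equiv.addRight (Pi.single i (1 : ZMod 2))) (chi k)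
  simp only [Equiv.coe_addRight, chi_add_right, hchi, mul_neg, mul_one,
    Finset.sum_neg_distrib] at h
  linarith

lemma sum_chi_mul_chi {n : ℕ} (k l : Fin n → ZMod 2) :
    ∑ r, chi k r * chi l r = if k = l then 2 ^ n else 0 := by
  simp only [← chi_add_left]
  split_ifs with h
  · subst h
    have h0 : k + k = 0 := funext fun i => CharTwo.add_self_eq_zero (k i)
    rw [h0]
    simp [chi, ip, ZMod.card]
  · refine sum_chi_eq_zero fun h0 => h ?_
    exact funext fun i => CharTwo.add_eq_zero.1 (congrFun h0 i)

/-- Parseval's identity on `{0,1}^n`. -/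
lemma sum_sq_sum_mul_chi {n : ℕ} (w : (Fin n → ZMod 2) → ℝ) :
    ∑ r, (∑ k, w k * chi k r) ^ 2 = 2 ^ n * ∑ k, w k ^ 2 := by
  calc ∑ r, (∑ k, w k * chi k r) ^ 2
      = ∑ r, ∑ k, ∑ l, w k * w l * (chi k r * chi l r) := by
        refine Finset.sum_congr rfl fun r _ => ?_
        rw [sq, Finset.sum_mul_sum]
        refine Finset.sum_congr rfl fun k _ => Finset.sum_congr rfl fun l _ => by ring
    _ = ∑ k, ∑ l, w k * w l * ∑ r, chi k r * chi l r := by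
        rw [Finset.sum_comm]
        refine Finset.sum_congr rfl fun k _ => ?_
        rw [Finset.sum_comm]
        simp only [Finset.mul_sum]
    _ = _ := by
        simp only [sum_chi_mul_chi, mul_ite, mul_zero, Finset.sum_ite_eq, Finset.mem_univ, if_true,
          Finset.mul_sum]
        refine Finset.sum_congr rfl fun k _ => by ring

/-- The weight of the bit value `b` when the keys have weights `w`, and the bit is `⟨k,r⟩`, except
that it is uniform for the keys in `g`. -/
noncomputable def bitWeight {n : ℕ} (w : (Fin n → ZMod 2) → ℝ) (g : (Fin n → ZMod 2) → Prop)
    [DecidablePred g] (r : Fin n → ZMod 2) (b : ZMod 2) : ℝ :=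
  ∑ k, if g k then w k / 2 else if ip k r = b then w k else 0

section bitWeight

variable {n : ℕ} {w : (Fin n → ZMod 2) → ℝ} (g : (Fin n → ZMod 2) → Prop) [DecidablePred g]

lemma bitWeight_nonneg (hw : ∀ k, 0 ≤ w k) (r : Fin n → ZMod 2) (b : ZMod 2) :
    0 ≤ bitWeight w g r b := by
  refine Finset.sum_nonneg fun k _ => ?_
  have := hw k
  split_ifs <;> linarith

lemma zmod_two_eq_one_iff (a : ZMod 2) : a = 1 ↔ ¬a = 0 := by
  revert a; decide

lemma bitWeight_add (r : Fin n → ZMod 2) :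
    bitWeight w g r 0 + bitWeight w g r 1 = ∑ k, w k := by
  rw [bitWeight, bitWeight, ← Finset.sum_add_distrib]
  refine Finset.sum_congr rfl fun k _ => ?_
  simp only [zmod_two_eq_one_iff]
  split_ifs <;> ring

lemma bitWeight_sub (r : Fin n → ZMod 2) :
    bitWeight w g r 0 - bitWeight w g r 1 = ∑ k, (if g k then 0 else w k) * chi k r := by
  rw [bitWeight, bitWeight, ← Finset.sum_sub_distrib]
  refine Finset.sum_congr rfl fun k _ => ?_
  simp only [zmod_two_eq_one_iff, chi]
  split_ifs <;> ring

lemma sum_sq_bitWeight_sub :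
    ∑ r, (bitWeight w g r 0 - bitWeight w g r 1) ^ 2 =
      2 ^ n * ∑ k, (if g k then 0 else w k) ^ 2 := by
  simp only [bitWeight_sub, sum_sq_sum_mul_chi]

/-- Entropy gained, summed over `r`, by replacing the bit `⟨k,r⟩` by a uniform one for `k ∈ g`. -/
lemma bitWeight_gain {c : ℝ} (hc : 0 < c) (hw : ∀ k, 0 ≤ w k) (hM : 0 < ∑ k, w k) :
    c * 2 ^ n * ((∑ k, w k ^ 2) / (6 * ∑ k, w k) -
        (∑ k, (if g k then 0 else w k) ^ 2) / ∑ k, w k) ≤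
      ∑ r, ∑ b, (Real.negMulLog (c * bitWeight w g r b) -
        Real.negMulLog (c * bitWeight w (fun _ => False) r b)) := by
  set M := ∑ k, w k
  have hpt : ∀ r : Fin n → ZMod 2,
      c * ((bitWeight w (fun _ => False) r 0 - bitWeight w (fun _ => False) r 1) ^ 2 / (6 * M) -
        (bitWeight w g r 0 - bitWeight w g r 1) ^ 2 / M) ≤
      ∑ b : ZMod 2, (Real.negMulLog (c * bitWeight w g r b) -
        Real.negMulLog (c * bitWeight w (fun _ => False) r b)) := by
    intro r
    have h0 := fun b => mul_nonneg hc.le (bitWeight_nonneg (fun _ => False) hw r b)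
    have h1 := fun b => mul_nonneg hc.le (bitWeight_nonneg g hw r b)
    have := negMulLog_pair_gain (h0 0) (h0 1) (h1 0) (h1 1) (mul_pos hc hM)
      (by rw [← mul_add, bitWeight_add]) (by rw [← mul_add, bitWeight_add])
    have hs : ∀ f : ZMod 2 → ℝ, ∑ b, f b = f 0 + f 1 := fun f => Fin.sum_univ_two f
    rw [hs]
    refine le_trans (le_of_eq ?_) (this.trans (le_of_eq ?_))
    · field_simp
    · ring
  refine le_trans (le_of_eq ?_) (Finset.sum_le_sum fun r _ => hpt r)
  rw [← Finset.mul_sum, Finset.sum_sub_distrib, ← Finset.sum_div, ← Finset.sum_div,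
    sum_sq_bitWeight_sub, sum_sq_bitWeight_sub]
  simp only [if_false]
  ring

/-- If `g` carries a `δ`-fraction of the weight, concentrated on a single key, while every other key
has at most an `ε`-fraction, then the gain is at least proportional to `δ ^ 2 / 6 - ε`. -/
lemma bitWeight_gain_of_unique {c δ ε : ℝ} (hc : 0 < c) (hw : ∀ k, 0 ≤ w k) (hM : 0 < ∑ k, w k)
    (hδ : 0 ≤ δ) (hε : 0 ≤ ε) (hg : δ * ∑ k, w k ≤ ∑ k, if g k then w k else 0)
    {k₀ : Fin n → ZMod 2} (hk₀ : ∀ k, g k → w k ≠ 0 → k = k₀)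
    (hlight : ∀ k, ¬g k → w k ≤ ε * ∑ k, w k) :
    c * 2 ^ n * ((δ ^ 2 / 6 - ε) * ∑ k, w k) ≤
      ∑ r, ∑ b, (Real.negMulLog (c * bitWeight w g r b) -
        Real.negMulLog (c * bitWeight w (fun _ => False) r b)) := by
  refine le_trans (mul_le_mul_of_nonneg_left ?_ (by positivity)) (bitWeight_gain g hc hw hM)
  set M := ∑ k, w k
  have h1 : δ * M ≤ w k₀ := by
    refine hg.trans ?_
    rw [Finset.sum_eq_single k₀ (fun k _ hk => ?_) (by simp)]
    · split_ifs
      · exact le_rfl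
      · exact hw _
    · split_ifs with h
      · by_contra h'
        exact hk (hk₀ k h h')
      · rfl
  have h2 : (δ * M) ^ 2 ≤ ∑ k, w k ^ 2 :=
    (pow_le_pow_left₀ (by positivity) h1 2).trans
      (Finset.single_le_sum (f := fun k => w k ^ 2) (fun k _ => sq_nonneg _) (Finset.mem_univ k₀))
  have h3 : ∑ k, (if g k then 0 else w k) ^ 2 ≤ ε * M * M := by
    have : ε * M * M = ∑ k, ε * M * w k := by rw [← Finset.mul_sum]
    rw [this]
    refine Finset.sum_le_sum fun k _ => ?_
    split_ifs with h
    · have := mul_nonneg (mul_nonneg hε hM.le) (hw k)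
      simpa using this
    · rw [sq]
      exact mul_le_mul_of_nonneg_right (hlight k h) (hw k)
  have h4 : (δ * M) ^ 2 / (6 * M) ≤ (∑ k, w k ^ 2) / (6 * M) := by gcongr
  have h5 : (∑ k, (if g k then 0 else w k) ^ 2) / M ≤ ε * M * M / M := by gcongr
  have h6 : (δ ^ 2 / 6 - ε) * M = (δ * M) ^ 2 / (6 * M) - ε * M * M / M := by
    field_simp
  linarith

end bitWeight

lemma shannonH_eq_sum_negMulLog {S : Type*} [Fintype S] (P : S → ℝ) :
    shannonH P = (∑ x, Real.negMulLog (P x)) / Real.log 2 := by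
  rw [shannonH, Finset.sum_div]
  refine Finset.sum_congr rfl fun x _ => ?_
  rw [Real.negMulLog, Real.logb]
  ring

lemma shannonH_sub_eq_sum {A B C R Y T : Type*} [Fintype A] [Fintype B] [Fintype C] [Fintype R]
    [Fintype Y] [Fintype T] (P Q : A × B × C × R × Y × T → ℝ) :
    shannonH P - shannonH Q = (∑ a, ∑ b, ∑ c, ∑ y, ∑ r, ∑ t,
      (Real.negMulLog (P (a, b, c, r, y, t)) - Real.negMulLog (Q (a, b, c, r, y, t)))) /
        Real.log 2 := by
  rw [shannonH_eq_sum_negMulLog, shannonH_eq_sum_negMulLog, ← sub_div, ← Finset.sum_sub_distrib]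
  simp only [Fintype.sum_prod_type]
  congr 1
  refine Finset.sum_congr rfl fun a _ => Finset.sum_congr rfl fun b _ =>
    Finset.sum_congr rfl fun c _ => ?_
  rw [Finset.sum_comm]

lemma eq_sum_mul_condKs {n : ℕ} {𝕊 : Type*} {μ : (Fin n → ZMod 2) × 𝕊 → ℝ} (hμ : ∀ x, 0 ≤ μ x)
    (s : 𝕊) (k : Fin n → ZMod 2) : μ (k, s) = (∑ k', μ (k', s)) * condKs μ s k := by
  rw [condKs]
  by_cases h : ∑ k', μ (k', s) = 0
  · rw [h, zero_mul]
    exact (Finset.sum_eq_zero_iff_of_nonneg fun k _ => hμ (k, s)).1 h k (Finset.mem_univ k)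
  · field_simp

lemma condKs_nonneg {n : ℕ} {𝕊 : Type*} {μ : (Fin n → ZMod 2) × 𝕊 → ℝ} (hμ : ∀ x, 0 ≤ μ x)
    (s : 𝕊) (k : Fin n → ZMod 2) : 0 ≤ condKs μ s k :=
  div_nonneg (hμ _) (Finset.sum_nonneg fun _ _ => hμ _)

section hybrids

variable {n : ℕ} {𝕊 Sg : Type*} [Fintype Sg]
  {μ : (Fin n → ZMod 2) × 𝕊 → ℝ}
  (h : Sg → (Fin n → ZMod 2) → (Fin (3 * n) → ZMod 2))
  (j : 𝕊 → ℕ) (F : 𝕊 → Finset (Sg × (Fin (3 * n) → ZMod 2)))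

/-- The conditional probabilities `K_s` restricted to the keys whose hash has a given prefix. -/
noncomputable def fiberWeight (μ : (Fin n → ZMod 2) × 𝕊 → ℝ)
    (h : Sg → (Fin n → ZMod 2) → (Fin (3 * n) → ZMod 2)) (s : 𝕊) (σ : Sg) (i : ℕ)
    (y : Fin (3 * n) → ZMod 2) (k : Fin n → ZMod 2) : ℝ :=
  if padPrefix n i (h σ k) = y then condKs μ s k else 0

lemma G0dist_eq (hμ : ∀ x, 0 ≤ μ x) (s : 𝕊) (σ : Sg) (i : Fin (3 * n)) (r : Fin n → ZMod 2)
    (y : Fin (3 * n) → ZMod 2) (b : ZMod 2) :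
    G0dist n μ h (s, σ, i, r, y, b) =
      1 / ((Fintype.card Sg : ℝ) * (3 * n) * 2 ^ n) * (∑ k, μ (k, s)) *
        bitWeight (fiberWeight μ h s σ (i + 1) y) (fun _ => False) r b := by
  simp only [G0dist, bitWeight, fiberWeight]
  refine Eq.trans ?_ (mul_assoc _ _ _).symm
  congr 1
  rw [Finset.mul_sum]
  refine Finset.sum_congr rfl fun k _ => ?_
  rw [eq_sum_mul_condKs hμ s k]
  by_cases h1 : padPrefix n (i + 1) (h σ k) = y <;> by_cases h2 : ip k r = b <;> simp [h1, h2]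

lemma G1dist_eq_of_mem [DecidableEq Sg] (hμ : ∀ x, 0 ≤ μ x) {s : 𝕊} {σ : Sg} {i : Fin (3 * n)} {y : Fin (3 * n) → ZMod 2}
    (hi : (i : ℕ) + 1 = iIdx n (j s)) (hy : (σ, y) ∈ F s) (r : Fin n → ZMod 2) (b : ZMod 2) :
    G1dist n μ h j F (s, σ, i, r, y, b) =
      1 / ((Fintype.card Sg : ℝ) * (3 * n) * 2 ^ n) * (∑ k, μ (k, s)) *
        bitWeight (fiberWeight μ h s σ (i + 1) y) (inG (condKs μ s) (j s)) r b := by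
  simp only [G1dist, bitWeight, fiberWeight]
  refine Eq.trans ?_ (mul_assoc _ _ _).symm
  congr 1
  rw [Finset.mul_sum]
  refine Finset.sum_congr rfl fun k _ => ?_
  rw [eq_sum_mul_condKs hμ s k, ← hi]
  by_cases h1 : padPrefix n (i + 1) (h σ k) = y
  · by_cases h2 : ip k r = b <;> by_cases h3 : inG (condKs μ s) (j s) k <;>
      simp [h1, h2, h3, hy, mul_div_assoc]
  · simp [h1]

lemma G1dist_eq_G0dist [DecidableEq Sg] {s : 𝕊} {σ : Sg} {i : Fin (3 * n)} {y : Fin (3 * n) → ZMod 2}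
    (hiy : ¬((i : ℕ) + 1 = iIdx n (j s) ∧ (σ, y) ∈ F s)) (r : Fin n → ZMod 2) (b : ZMod 2) :
    G1dist n μ h j F (s, σ, i, r, y, b) = G0dist n μ h (s, σ, i, r, y, b) := by
  simp only [G1dist, G0dist]
  congr 1
  refine Finset.sum_congr rfl fun k _ => ?_
  by_cases h1 : padPrefix n (i + 1) (h σ k) = y
  · rw [if_neg]
    rintro ⟨h2, -, h3⟩
    rw [← h2, h1] at h3
    exact hiy ⟨h2, h3⟩
  · simp [h1]

/-- The entropy gain conditioned on a hash prefix `y` with `(σ, y) ∈ F_s`. -/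
lemma hybrid_gain_of_mem [DecidableEq Sg] [Nonempty Sg] (hμ : ∀ x, 0 ≤ μ x) (hn : 2 ≤ n) {s : 𝕊} (hs : 0 < ∑ k, μ (k, s)) {σ : Sg}
    {i : Fin (3 * n)} {y : Fin (3 * n) → ZMod 2}
    (hi : (i : ℕ) + 1 = iIdx n (j s)) (hy : (σ, y) ∈ F s)
    (hG : 1 / (6 * (n : ℝ)) ≤
      (∑ k, if inG (condKs μ s) (j s) k ∧ padPrefix n (iIdx n (j s)) (h σ k) = y
            then condKs μ s k else 0)
        / (∑ k, if padPrefix n (iIdx n (j s)) (h σ k) = y then condKs μ s k else 0))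
    (huniq : ∀ k1 k2 : Fin n → ZMod 2,
      1 / 2 ^ (j s) / (n : ℝ) ^ 500 ≤ condKs μ s k1 →
      padPrefix n (iIdx n (j s)) (h σ k1) = y →
      1 / 2 ^ (j s) / (n : ℝ) ^ 500 ≤ condKs μ s k2 →
      padPrefix n (iIdx n (j s)) (h σ k2) = y → k1 = k2) :
    (∑ k, μ (k, s)) / ((Fintype.card Sg : ℝ) * (3 * n)) *
        (((1 / (6 * (n : ℝ))) ^ 2 / 6 - 2 / (n : ℝ) ^ 500) *
          ∑ k, fiberWeight μ h s σ (iIdx n (j s)) y k) ≤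
      ∑ r, ∑ b, (Real.negMulLog (G1dist n μ h j F (s, σ, i, r, y, b)) -
        Real.negMulLog (G0dist n μ h (s, σ, i, r, y, b))) := by
  have hn0 : (0 : ℝ) < n := by positivity
  have hcard : (0 : ℝ) < Fintype.card Sg := by exact_mod_cast Fintype.card_pos
  have hK := condKs_nonneg hμ s
  simp only [G0dist_eq h hμ, G1dist_eq_of_mem h j F hμ hi hy]
  rw [hi]
  set w := fiberWeight μ h s σ (iIdx n (j s)) y
  have hwk : ∀ k, w k = if padPrefix n (iIdx n (j s)) (h σ k) = y then condKs μ s k else 0 :=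
    fun k => rfl
  have hw : ∀ k, 0 ≤ w k := fun k => by
    rw [hwk]; split_ifs
    · exact hK k
    · exact le_rfl
  have hgsum : (∑ k, if inG (condKs μ s) (j s) k ∧ padPrefix n (iIdx n (j s)) (h σ k) = y
      then condKs μ s k else 0) = ∑ k, if inG (condKs μ s) (j s) k then w k else 0 :=
    Finset.sum_congr rfl fun k _ => by rw [hwk, ite_and]
  rw [hgsum] at hG
  change _ ≤ _ / ∑ k, w k at hG
  have hpos : 0 < 1 / (6 * (n : ℝ)) := by positivity
  have hM : 0 < ∑ k, w k := by
    refine (Finset.sum_nonneg fun k _ => hw k).lt_of_ne' fun h0 => ?_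
    rw [h0, div_zero] at hG
    linarith
  rw [le_div_iff₀ hM] at hG
  have hpow : (2 : ℝ) ≤ (n : ℝ) ^ 500 := by
    have h2 : (2 : ℝ) ≤ n := by exact_mod_cast hn
    exact h2.trans (le_self_pow₀ (by linarith) (by norm_num))
  have heavy : ∀ k, inG (condKs μ s) (j s) k →
      1 / 2 ^ (j s) / (n : ℝ) ^ 500 ≤ condKs μ s k := by
    intro k hk
    refine le_trans ?_ hk.1
    rw [pow_succ (2 : ℝ) (j s), ← div_div]
    gcongr
  have hfib : ∀ k, w k ≠ 0 → padPrefix n (iIdx n (j s)) (h σ k) = y := by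
    intro k hk
    by_contra h'
    exact hk (by rw [hwk, if_neg h'])
  obtain ⟨k₀, -, hk₀⟩ : ∃ k₀ ∈ Finset.univ,
      (if inG (condKs μ s) (j s) k₀ then w k₀ else 0) ≠ 0 :=
    Finset.exists_ne_zero_of_sum_ne_zero ((mul_pos hpos hM).trans_le hG).ne'
  obtain ⟨hk₀G, hk₀w⟩ : inG (condKs μ s) (j s) k₀ ∧ w k₀ ≠ 0 := by
    split_ifs at hk₀ with h'
    · exact ⟨h', hk₀⟩
    · exact absurd rfl hk₀
  have hlight : ∀ k, ¬inG (condKs μ s) (j s) k → w k ≤ 2 / (n : ℝ) ^ 500 * ∑ k, w k := by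
    intro k hk
    by_cases hwk0 : w k = 0
    · rw [hwk0]; positivity
    have hlt : condKs μ s k < 1 / 2 ^ (j s) / (n : ℝ) ^ 500 := by
      by_contra! hge
      exact hk (huniq k k₀ hge (hfib k hwk0) (heavy k₀ hk₀G) (hfib k₀ hk₀w) ▸ hk₀G)
    have e1 : w k = condKs μ s k := by rw [hwk, if_pos (hfib k hwk0)]
    have e2 : w k₀ = condKs μ s k₀ := by rw [hwk, if_pos (hfib k₀ hk₀w)]
    have h1 : w k₀ ≤ ∑ k, w k :=
      Finset.single_le_sum (fun k _ => hw k) (Finset.mem_univ k₀)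
    calc w k ≤ 1 / 2 ^ (j s) / (n : ℝ) ^ 500 := e1 ▸ hlt.le
      _ = 2 / (n : ℝ) ^ 500 * (1 / 2 ^ (j s + 1)) := by
        rw [pow_succ (2 : ℝ) (j s)]
        field_simp
      _ ≤ 2 / (n : ℝ) ^ 500 * w k₀ := by
        rw [e2]; exact mul_le_mul_of_nonneg_left hk₀G.1 (by positivity)
      _ ≤ _ := by gcongr
  have := bitWeight_gain_of_unique (inG (condKs μ s) (j s))
    (c := 1 / ((Fintype.card Sg : ℝ) * (3 * n) * 2 ^ n) * (∑ k, μ (k, s)))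
    (by positivity) hw hM hpos.le (ε := 2 / (n : ℝ) ^ 500) (by positivity) hG
    (fun k hk hk0 => huniq k k₀ (heavy k hk) (hfib k hk0) (heavy k₀ hk₀G) (hfib k₀ hk₀w)) hlight
  refine le_trans (le_of_eq ?_) this
  field_simp

end hybrids

/-- Summing over `y` turns fibre weights into the probability of `(σ, h_σ(k)_i) ∈ F`. -/
lemma sum_fiberWeight {n : ℕ} {𝕊 Sg : Type*} [Fintype Sg] [DecidableEq Sg]
    (μ : (Fin n → ZMod 2) × 𝕊 → ℝ) (h : Sg → (Fin n → ZMod 2) → (Fin (3 * n) → ZMod 2))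
    (F : Finset (Sg × (Fin (3 * n) → ZMod 2))) (s : 𝕊) (σ : Sg) (i : ℕ) :
    (∑ y, if (σ, y) ∈ F then ∑ k, fiberWeight μ h s σ i y k else 0) =
      ∑ k, if (σ, padPrefix n i (h σ k)) ∈ F then condKs μ s k else 0 := by
  have : ∀ y, (if (σ, y) ∈ F then ∑ k, fiberWeight μ h s σ i y k else 0) =
      ∑ k, if padPrefix n i (h σ k) = y then (if (σ, y) ∈ F then condKs μ s k else 0) else 0 := by
    intro y
    split_ifs <;> simp [fiberWeight]
  simp only [this]
  rw [Finset.sum_comm]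
  simp

lemma gain_numeric {x : ℝ} (hx : 20000 ≤ x) :
    0 ≤ (1 / (6 * x)) ^ 2 / 6 - 2 / x ^ 500 ∧
    1 / x ^ 5 ≤ 1 / (3 * x) * (((1 / (6 * x)) ^ 2 / 6 - 2 / x ^ 500) *
      (1 / (6 * x) - 1 / x ^ 100)) := by
  have hx0 : 0 < x := by linarith
  have hx1 : 1 ≤ x := by linarith
  have h1 : 1 / (432 * x ^ 2) ≤ (1 / (6 * x)) ^ 2 / 6 - 2 / x ^ 500 := by
    have h3 : 2 / x ^ 500 ≤ 2 / x ^ 3 := by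
      exact div_le_div_of_nonneg_left (by norm_num) (by positivity)
        (pow_le_pow_right₀ hx1 (by norm_num))
    have h4 : 2 / x ^ 3 ≤ 1 / (432 * x ^ 2) := by
      rw [div_le_div_iff₀ (by positivity) (by positivity)]
      nlinarith [sq_nonneg x]
    have h5 : (1 / (6 * x)) ^ 2 / 6 = 1 / (432 * x ^ 2) + 1 / (432 * x ^ 2) := by
      field_simp; norm_num
    linarith
  have h2 : 1 / (12 * x) ≤ 1 / (6 * x) - 1 / x ^ 100 := by
    have h3 : 1 / x ^ 100 ≤ 1 / x ^ 2 := by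
      exact div_le_div_of_nonneg_left (by norm_num) (by positivity)
        (pow_le_pow_right₀ hx1 (by norm_num))
    have h4 : 1 / x ^ 2 ≤ 1 / (12 * x) := by
      rw [div_le_div_iff₀ (by positivity) (by positivity)]
      nlinarith
    have h5 : 1 / (6 * x) = 1 / (12 * x) + 1 / (12 * x) := by
      field_simp; norm_num
    linarith
  have h0 : 0 ≤ 1 / (432 * x ^ 2) := by positivity
  refine ⟨h0.trans h1, ?_⟩
  calc 1 / x ^ 5 ≤ 1 / (3 * x) * (1 / (432 * x ^ 2) * (1 / (12 * x))) := by
        have : 1 / (3 * x) * (1 / (432 * x ^ 2) * (1 / (12 * x))) = 1 / (15552 * x ^ 4) := by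
          field_simp; norm_num
        rw [this]
        refine one_div_le_one_div_of_le (by positivity) ?_
        have := mul_le_mul_of_nonneg_right (show 15552 ≤ x by linarith) (pow_nonneg hx0.le 4)
        linarith [pow_succ' x 4]
    _ ≤ _ := by
        have := h0.trans h1
        gcongr

theorem stmt14 :
    ∃ N : ℕ, ∀ n : ℕ, N ≤ n →
      ∀ (𝕊 Sg : Type) [Fintype 𝕊] [Fintype Sg] [Nonempty Sg] [DecidableEq Sg],
      ∀ μ : (Fin n → ZMod 2) × 𝕊 → ℝ, IsDist μ →
      ∀ h : Sg → (Fin n → ZMod 2) → (Fin (3 * n) → ZMod 2),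
        -- the family `h` is pairwise independent
        (∀ x y : Fin n → ZMod 2, x ≠ y → ∀ a b : Fin (3 * n) → ZMod 2,
          ((Finset.univ.filter fun σ : Sg => h σ x = a ∧ h σ y = b).card : ℝ)
              / (Fintype.card Sg : ℝ) = 1 / 2 ^ (2 * (3 * n))) →
      ∀ j : 𝕊 → ℕ, ∀ F : 𝕊 → Finset (Sg × (Fin (3 * n) → ZMod 2)),
        (∀ s : 𝕊, 0 < (∑ k, μ (k, s)) →
          -- 0 ≤ j_s ≤ 2n - 1
          j s ≤ 2 * n - 1 ∧
          -- K_s(G_s) ≥ 1/(3n)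
          (1 / (3 * (n : ℝ)) ≤
            ∑ k, if inG (condKs μ s) (j s) k then condKs μ s k else 0) ∧
          -- i_s ≤ 3n
          iIdx n (j s) ≤ 3 * n ∧
          -- (a) Pr_{σ←Σ, k←K_s}[(σ, h_σ(k)_{i_s}) ∈ F_s] ≥ 1/(6n) - 1/n^100
          (1 / (6 * (n : ℝ)) - 1 / (n : ℝ) ^ 100 ≤
            ∑ σ : Sg, ∑ k : Fin n → ZMod 2,
              if (σ, padPrefix n (iIdx n (j s)) (h σ k)) ∈ F s
              then (1 / (Fintype.card Sg : ℝ)) * condKs μ s k else 0) ∧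
          -- (b) for every (σ, y) ∈ F_s:
          (∀ σ : Sg, ∀ y : Fin (3 * n) → ZMod 2, (σ, y) ∈ F s →
            -- Pr_{k←K_s}[k ∈ G_s | h_σ(k)_{i_s} = y] ≥ 1/(6n)
            (1 / (6 * (n : ℝ)) ≤
              (∑ k, if inG (condKs μ s) (j s) k ∧ padPrefix n (iIdx n (j s)) (h σ k) = y
                    then condKs μ s k else 0)
                / (∑ k, if padPrefix n (iIdx n (j s)) (h σ k) = y
                        then condKs μ s k else 0)) ∧
            -- at most one `k` with `K_s k ≥ 2^{-j_s}·n^{-500}` has `h_σ(k)_{i_s} = y`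
            (∀ k1 k2 : Fin n → ZMod 2,
              1 / 2 ^ (j s) / (n : ℝ) ^ 500 ≤ condKs μ s k1 →
              padPrefix n (iIdx n (j s)) (h σ k1) = y →
              1 / 2 ^ (j s) / (n : ℝ) ^ 500 ≤ condKs μ s k2 →
              padPrefix n (iIdx n (j s)) (h σ k2) = y →
              k1 = k2))) →
        shannonH (G1dist n μ h j F) - shannonH (G0dist n μ h) ≥ 1 / (n : ℝ) ^ 5 := by

  refine ⟨20000, fun n hn 𝕊 Sg _ _ _ _ μ hμ h _ j F hF => ?_⟩
  obtain ⟨hμ0, hμ1⟩ := hμ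
  have hx : (20000 : ℝ) ≤ n := by exact_mod_cast hn
  have hn0 : (0 : ℝ) < n := by linarith
  have hcard : (0 : ℝ) < Fintype.card Sg := by exact_mod_cast Fintype.card_pos
  obtain ⟨hκ, hnum⟩ := gain_numeric hx
  set κ := (1 / (6 * (n : ℝ))) ^ 2 / 6 - 2 / (n : ℝ) ^ 500
  let D : 𝕊 → Sg → Fin (3 * n) → (Fin (3 * n) → ZMod 2) → ℝ := fun s σ i y =>
    ∑ r, ∑ b, (Real.negMulLog (G1dist n μ h j F (s, σ, i, r, y, b)) -
      Real.negMulLog (G0dist n μ h (s, σ, i, r, y, b)))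
  have hsum : shannonH (G1dist n μ h j F) - shannonH (G0dist n μ h) =
      (∑ s, ∑ σ, ∑ i, ∑ y, D s σ i y) / Real.log 2 :=
    shannonH_sub_eq_sum _ _
  have hD0 : ∀ s σ (i : Fin (3 * n)) y, ¬((i : ℕ) + 1 = iIdx n (j s) ∧ (σ, y) ∈ F s) → D s σ i y = 0 := by
    intro s σ i y hiy
    simp only [D, G1dist_eq_G0dist h j F hiy, sub_self, Finset.sum_const_zero]
  have hs : ∀ s, (∑ k, μ (k, s)) * (1 / (n : ℝ) ^ 5) ≤ ∑ σ, ∑ i, ∑ y, D s σ i y := by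
    intro s
    rcases (Finset.sum_nonneg fun k _ => hμ0 (k, s) : 0 ≤ ∑ k, μ (k, s)).eq_or_lt with hp | hp
    · have hD : ∀ σ i y, D s σ i y = 0 := by
        intro σ i y
        by_cases hiy : (i : ℕ) + 1 = iIdx n (j s) ∧ (σ, y) ∈ F s
        · simp only [D, G0dist_eq h hμ0, G1dist_eq_of_mem h j F hμ0 hiy.1 hiy.2, ← hp]
          simp
        · exact hD0 s σ i y hiy
      simp [← hp, hD]
    obtain ⟨-, -, hi, ha, hb⟩ := hF s hp
    have hlog : 0 < Real.logb 2 (n : ℝ) := Real.logb_pos (by norm_num) (by linarith)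
    have hi1 : 1 ≤ iIdx n (j s) := by
      have : 0 < ⌈(600 : ℝ) * Real.logb 2 (n : ℝ)⌉₊ := Nat.ceil_pos.2 (by positivity)
      rw [iIdx]; omega
    let i₀ : Fin (3 * n) := ⟨iIdx n (j s) - 1, by omega⟩
    have hi₀ : (i₀ : ℕ) + 1 = iIdx n (j s) := Nat.sub_add_cancel hi1
    have hsi : ∀ σ, ∑ i, ∑ y, D s σ i y = ∑ y, D s σ i₀ y := by
      intro σ
      refine Finset.sum_eq_single i₀ (fun i _ hne => ?_) (by simp)
      refine Finset.sum_eq_zero fun y _ => hD0 s σ i y fun hiy => hne (Fin.ext ?_)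
      have := hiy.1
      omega
    have hlow : ∀ σ y, (∑ k, μ (k, s)) / ((Fintype.card Sg : ℝ) * (3 * n)) * (κ *
        if (σ, y) ∈ F s then ∑ k, fiberWeight μ h s σ (iIdx n (j s)) y k else 0) ≤
        D s σ i₀ y := by
      intro σ y
      split_ifs with hy
      · exact hybrid_gain_of_mem h j F hμ0 (by omega) hp hi₀ hy (hb σ y hy).1 (hb σ y hy).2
      · rw [hD0 s σ i₀ y fun hiy => hy hiy.2]; simp
    have ha' : (Fintype.card Sg : ℝ) * (1 / (6 * (n : ℝ)) - 1 / (n : ℝ) ^ 100) ≤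
        ∑ σ, ∑ y, if (σ, y) ∈ F s then ∑ k, fiberWeight μ h s σ (iIdx n (j s)) y k else 0 := by
      simp only [sum_fiberWeight]
      rw [← le_div_iff₀' hcard]
      refine ha.trans (le_of_eq ?_)
      simp only [Finset.sum_div]
      refine Finset.sum_congr rfl fun σ _ => Finset.sum_congr rfl fun k _ => ?_
      split_ifs <;> ring
    calc (∑ k, μ (k, s)) * (1 / (n : ℝ) ^ 5)
        ≤ (∑ k, μ (k, s)) * (1 / (3 * n) * (κ * (1 / (6 * (n : ℝ)) - 1 / (n : ℝ) ^ 100))) := by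
          gcongr
      _ = (∑ k, μ (k, s)) / ((Fintype.card Sg : ℝ) * (3 * n)) *
            (κ * ((Fintype.card Sg : ℝ) * (1 / (6 * (n : ℝ)) - 1 / (n : ℝ) ^ 100))) := by
          field_simp
      _ ≤ (∑ k, μ (k, s)) / ((Fintype.card Sg : ℝ) * (3 * n)) * (κ * ∑ σ, ∑ y,
            if (σ, y) ∈ F s then ∑ k, fiberWeight μ h s σ (iIdx n (j s)) y k else 0) := by
          gcongr
      _ ≤ ∑ σ, ∑ y, D s σ i₀ y := by
          simp only [Finset.mul_sum (s := (Finset.univ : Finset Sg)),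
            Finset.mul_sum (s := (Finset.univ : Finset (Fin (3 * n) → ZMod 2)))]
          exact Finset.sum_le_sum fun σ _ => Finset.sum_le_sum fun y _ => hlow σ y
      _ = _ := by simp only [hsi]
  have htotal : 1 / (n : ℝ) ^ 5 ≤ ∑ s, ∑ σ, ∑ i, ∑ y, D s σ i y := by
    refine le_trans (le_of_eq ?_) (Finset.sum_le_sum fun s _ => hs s)
    rw [← Finset.sum_mul, Finset.sum_comm, ← Fintype.sum_prod_type, hμ1, one_mul]
  have hlog2 : Real.log 2 ≤ 1 := by linarith [Real.log_two_lt_d9]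
  rw [hsum, ge_iff_le, le_div_iff₀ (Real.log_pos (by norm_num))]
  refine le_trans (mul_le_of_le_one_right (by positivity) hlog2) htotal
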